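/- Let ρ : ℝ → ℝ be a C^∞ function. For every ε > 0 there exists δ > 0 such that for all ℓ ∈ ℝ with |ℓ| < δ, all x ∈ [0, 1], and all v = (v₁, v₂) ∈ ℝ²: |(v₁² + cosh²(x)·(ℓ·ρ'(x)·v₁ + v₂)²) − (v₁² + cosh²(x)·v₂²)| ≤ ε·(v₁² + cosh²(x)·v₂²), where ρ' denotes the derivative of ρ. -/

import Mathlib

/-- Shearing `(b, w)` to `(b, a * b + w)` changes the squared norm by a factor of at most
`a ^ 2 + |a|`. -/
theorem abs_sq_add_shear_sq_sub_le (a b w : ℝ) :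
    |(b ^ 2 + (a * b + w) ^ 2) - (b ^ 2 + w ^ 2)| ≤ (a ^ 2 + |a|) * (b ^ 2 + w ^ 2) := by
  have h : |2 * b * w| ≤ b ^ 2 + w ^ 2 :=
    abs_le.2 ⟨by nlinarith [sq_nonneg (b + w)], by nlinarith [sq_nonneg (b - w)]⟩
  calc |(b ^ 2 + (a * b + w) ^ 2) - (b ^ 2 + w ^ 2)| = |a ^ 2 * b ^ 2 + a * (2 * b * w)| := by
        ring_nf
    _ ≤ |a ^ 2 * b ^ 2| + |a * (2 * b * w)| := abs_add_le _ _
    _ = a ^ 2 * b ^ 2 + |a| * |2 * b * w| := by rw [abs_of_nonneg (by positivity), abs_mul]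
    _ ≤ a ^ 2 * (b ^ 2 + w ^ 2) + |a| * (b ^ 2 + w ^ 2) := by
        gcongr
        exact le_add_of_nonneg_right (sq_nonneg w)
    _ = (a ^ 2 + |a|) * (b ^ 2 + w ^ 2) := by ring

/-- The pullback of the collar metric `v₁² + cosh²(x)·v₂²` under the Dehn twist
`(x, y) ↦ (x, y + ℓ·ρ(x))`, whose differential sends `(v₁, v₂)` to
`(v₁, ℓ·ρ'(x)·v₁ + v₂)`, converges to the metric uniformly on the collar as
`ℓ → 0`. -/
theorem stmt5 (ρ : ℝ → ℝ) (hρ : ContDiff ℝ (⊤ : ℕ∞) ρ) :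
    ∀ ε > 0, ∃ δ > 0, ∀ ℓ : ℝ, |ℓ| < δ →
      ∀ x ∈ Set.Icc (0 : ℝ) 1, ∀ v : ℝ × ℝ,
        |(v.1 ^ 2 + Real.cosh x ^ 2 * (ℓ * deriv ρ x * v.1 + v.2) ^ 2) -
            (v.1 ^ 2 + Real.cosh x ^ 2 * v.2 ^ 2)| ≤
          ε * (v.1 ^ 2 + Real.cosh x ^ 2 * v.2 ^ 2) := by
  intro ε hε
  have hcont : Continuous fun x => Real.cosh x * deriv ρ x :=
    Real.continuous_cosh.mul (hρ.continuous_deriv (by simp))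
  obtain ⟨M, hM⟩ := isCompact_Icc.exists_bound_of_continuousOn
    (s := Set.Icc (0 : ℝ) 1) hcont.continuousOn
  have hM_pos : 0 < |M| + 1 := by positivity
  refine ⟨min 1 (ε / 2) / (|M| + 1), by positivity, fun ℓ hℓ x hx v => ?_⟩
  set a := ℓ * (Real.cosh x * deriv ρ x) with ha
  have ha_lt : |a| < min 1 (ε / 2) := by
    rw [lt_div_iff₀ hM_pos] at hℓ
    refine lt_of_le_of_lt ?_ hℓ
    rw [ha, abs_mul]
    gcongr
    have h := hM x hx
    rw [Real.norm_eq_abs] at h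
    linarith [le_abs_self M]
  obtain ⟨ha_one, ha_eps⟩ := lt_min_iff.1 ha_lt
  have ha_sum : a ^ 2 + |a| ≤ ε := by
    nlinarith [sq_abs a, abs_nonneg a]
  have hshear := abs_sq_add_shear_sq_sub_le a v.1 (Real.cosh x * v.2)
  have hsq : Real.cosh x ^ 2 * (ℓ * deriv ρ x * v.1 + v.2) ^ 2 =
      (a * v.1 + Real.cosh x * v.2) ^ 2 := by
    rw [ha]
    ring
  rw [hsq, ← mul_pow]
  exact hshear.trans (by gcongr)
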